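/- Let φ be a smooth real-valued function on an open neighbourhood of the closed unit disc with φ = 0 on the unit circle, set B = Δφ and A = (−∂₂φ, ∂₁φ), and let g : ℝ → ℝ be continuous and 2π-periodic. Define Φ = (1/(2π)) ∫_D B dx and Φ_g = (1/(2π)) ∫_0^{2π} g(θ) dθ, and assume Φ − Φ_g > 0; let N = ⌈Φ − Φ_g⌉. Then there exist N complex polynomials p₁, …, p_N in the variable z = x₁ + i x₂, linearly independent over ℂ, such that for every nonzero polynomial p in their span, the function u = e^{−φ} p satisfies ∫_D ( |(−i∇ − A)u|² − B |u|² ) dx + ∫_0^{2π} g(θ) |u(e^{iθ})|² dθ < 0. -/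

import Mathlib

open MeasureTheory

/-- Partial derivative `∂₁` of a function on `ℂ ≅ ℝ²` (direction `1`). -/
noncomputable def pd1 (u : ℂ → ℂ) (z : ℂ) : ℂ := fderiv ℝ u z 1

/-- Partial derivative `∂₂` of a function on `ℂ ≅ ℝ²` (direction `i`). -/
noncomputable def pd2 (u : ℂ → ℂ) (z : ℂ) : ℂ := fderiv ℝ u z Complex.I

/-- Partial derivative `∂₁` of a real-valued function on `ℂ ≅ ℝ²`. -/
noncomputable def pd1R (φ : ℂ → ℝ) (z : ℂ) : ℝ := fderiv ℝ φ z 1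

/-- Partial derivative `∂₂` of a real-valued function on `ℂ ≅ ℝ²`. -/
noncomputable def pd2R (φ : ℂ → ℝ) (z : ℂ) : ℝ := fderiv ℝ φ z Complex.I

/-- First component of the vector potential `A = (-∂₂φ, ∂₁φ)`. -/
noncomputable def A1f (φ : ℂ → ℝ) (z : ℂ) : ℝ := -(pd2R φ z)

/-- Second component of the vector potential `A = (-∂₂φ, ∂₁φ)`. -/
noncomputable def A2f (φ : ℂ → ℝ) (z : ℂ) : ℝ := pd1R φ z

/-- The magnetic field `B = Δφ = ∂₁∂₁φ + ∂₂∂₂φ`. -/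
noncomputable def Bf (φ : ℂ → ℝ) (z : ℂ) : ℝ :=
  pd1R (pd1R φ) z + pd2R (pd2R φ) z

/-- Components of `(-i∇ - A)u`. -/
noncomputable def mag1 (φ : ℂ → ℝ) (u : ℂ → ℂ) (z : ℂ) : ℂ :=
  -Complex.I * pd1 u z - (A1f φ z : ℂ) * u z

noncomputable def mag2 (φ : ℂ → ℝ) (u : ℂ → ℂ) (z : ℂ) : ℂ :=
  -Complex.I * pd2 u z - (A2f φ z : ℂ) * u z

/-- The Robin quadratic form of `(-i∇-A)² - B` on the unit disc. -/
noncomputable def qform (φ : ℂ → ℝ) (g : ℝ → ℝ) (u : ℂ → ℂ) : ℝ :=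
  (∫ z in Metric.ball (0:ℂ) 1,
    (‖mag1 φ u z‖ ^ 2 + ‖mag2 φ u z‖ ^ 2 - Bf φ z * ‖u z‖ ^ 2))
  + ∫ θ in (0:ℝ)..(2 * Real.pi), g θ * ‖u (Complex.exp (Complex.I * θ))‖ ^ 2

/-- The polar coordinate map `(r, θ) ↦ r e^{iθ}`. -/
noncomputable def polarMap (p : ℝ × ℝ) : ℂ := (p.1 : ℂ) * Complex.exp (Complex.I * p.2)

theorem hasFDerivAt_polarMap (p : ℝ × ℝ) :
    HasFDerivAt polarMap
      ((ContinuousLinearMap.fst ℝ ℝ ℝ).smulRight (Complex.exp (Complex.I * p.2)) +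
        (ContinuousLinearMap.snd ℝ ℝ ℝ).smulRight
          (p.1 * (Complex.I * Complex.exp (Complex.I * p.2)))) p := by
  have h1 : HasFDerivAt (fun p : ℝ × ℝ => (p.1 : ℂ))
      (Complex.ofRealCLM.comp (ContinuousLinearMap.fst ℝ ℝ ℝ)) p :=
    Complex.ofRealCLM.hasFDerivAt.comp p hasFDerivAt_fst
  have h2 : HasFDerivAt (fun p : ℝ × ℝ => (p.2 : ℂ))
      (Complex.ofRealCLM.comp (ContinuousLinearMap.snd ℝ ℝ ℝ)) p :=
    Complex.ofRealCLM.hasFDerivAt.comp p hasFDerivAt_snd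
  have h3 := h1.mul (h2.const_mul Complex.I).cexp
  refine h3.congr_fderiv ?_
  refine ContinuousLinearMap.ext fun v => ?_
  simp
  ring

theorem continuous_polarMap : Continuous polarMap :=
  continuous_iff_continuousAt.2 fun p => (hasFDerivAt_polarMap p).continuousAt

theorem norm_polarMap (p : ℝ × ℝ) : ‖polarMap p‖ = |p.1| := by
  simp [polarMap, mul_comm Complex.I, Complex.norm_exp_ofReal_mul_I]

theorem exp_I_mul_eq (θ : ℝ) :
    Complex.exp (Complex.I * θ) = (Real.cos θ : ℂ) + Real.sin θ * Complex.I := by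
  rw [mul_comm, Complex.exp_mul_I]; simp

theorem polarMap_mem {p : ℝ × ℝ} (hp : p ∈ Set.Icc ((0 : ℝ), -Real.pi) (1, Real.pi)) :
    polarMap p ∈ Metric.closedBall (0 : ℂ) 1 := by
  rw [mem_closedBall_zero_iff, norm_polarMap, abs_of_nonneg hp.1.1]
  exact hp.2.1

theorem setIntegral_ball_eq_polar (f : ℂ → ℝ) :
    ∫ z in Metric.ball (0 : ℂ) 1, f z =
      ∫ p in Set.Icc ((0 : ℝ), -Real.pi) (1, Real.pi), p.1 * f (polarMap p) := by
  rw [← integral_indicator Metric.isOpen_ball.measurableSet,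
    ← Complex.integral_comp_polarCoord_symm, ← Set.Icc_prod_Icc]
  have hae : (Set.Icc (0 : ℝ) 1 ×ˢ Set.Icc (-Real.pi) Real.pi : Set (ℝ × ℝ)) =ᵐ[volume]
      (Set.Ioo (0 : ℝ) 1 ×ˢ Set.Ioo (-Real.pi) Real.pi : Set (ℝ × ℝ)) :=
    (Measure.set_prod_ae_eq Ioo_ae_eq_Icc Ioo_ae_eq_Icc).symm
  rw [setIntegral_congr_set hae]
  have hm : MeasurableSet (Set.Ioo (0 : ℝ) 1 ×ˢ Set.Ioo (-Real.pi) Real.pi) :=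
    measurableSet_Ioo.prod measurableSet_Ioo
  rw [← integral_indicator hm, ← integral_indicator polarCoord.open_target.measurableSet]
  congr 1
  ext p
  have hpm : Complex.polarCoord.symm p = polarMap p := by
    rw [Complex.polarCoord_symm_apply, polarMap, exp_I_mul_eq]
  simp only [Set.indicator, hpm, mem_ball_zero_iff, norm_polarMap, polarCoord_target,
    Set.mem_prod, Set.mem_Ioi, Set.mem_Ioo, smul_eq_mul]
  by_cases h0 : 0 < p.1 <;> by_cases h1 : p.1 < 1 <;>
    by_cases h2 : -Real.pi < p.2 <;> by_cases h3 : p.2 < Real.pi <;>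
    simp [h0, h1, h2, h3, abs_of_pos]

/-- **Divergence theorem** on the unit disc. -/
theorem integral_ball_divergence {U : Set ℂ} (hU : IsOpen U)
    (hDU : Metric.closedBall (0 : ℂ) 1 ⊆ U) {X Y : ℂ → ℝ}
    (hX : ContDiffOn ℝ 1 X U) (hY : ContDiffOn ℝ 1 Y U) :
    ∫ z in Metric.ball (0 : ℂ) 1, (fderiv ℝ X z 1 + fderiv ℝ Y z Complex.I) =
      ∫ θ in (0 : ℝ)..(2 * Real.pi), (X (Complex.exp (Complex.I * θ)) * Real.cos θ +
        Y (Complex.exp (Complex.I * θ)) * Real.sin θ) := by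
  rw [setIntegral_ball_eq_polar]
  have hd : ∀ Z : ℂ → ℝ, ContDiffOn ℝ 1 Z U → ∀ p ∈ Set.Icc ((0 : ℝ), -Real.pi) (1, Real.pi),
      HasFDerivAt (fun p => Z (polarMap p)) ((fderiv ℝ Z (polarMap p)).comp
        ((ContinuousLinearMap.fst ℝ ℝ ℝ).smulRight (Complex.exp (Complex.I * p.2)) +
        (ContinuousLinearMap.snd ℝ ℝ ℝ).smulRight
          (p.1 * (Complex.I * Complex.exp (Complex.I * p.2))))) p := by
    intro Z hZ p hp
    have : DifferentiableAt ℝ Z (polarMap p) :=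
      (hZ.differentiableOn one_ne_zero).differentiableAt (hU.mem_nhds (hDU (polarMap_mem hp)))
    exact this.hasFDerivAt.comp p (hasFDerivAt_polarMap p)
  have hc : ∀ Z : ℂ → ℝ, ContDiffOn ℝ 1 Z U → ∀ v, ContinuousOn
      (fun p => fderiv ℝ Z (polarMap p) v) (Set.Icc ((0 : ℝ), -Real.pi) (1, Real.pi)) := by
    intro Z hZ v
    have h1 : ContinuousOn (fun z => fderiv ℝ Z z v) U :=
      (hZ.continuousOn_fderiv_of_isOpen hU le_rfl).clm_apply continuousOn_const
    exact h1.comp continuous_polarMap.continuousOn fun p hp => hDU (polarMap_mem hp)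
  set f : ℝ × ℝ → ℝ := fun p =>
    p.1 * (X (polarMap p) * Real.cos p.2 + Y (polarMap p) * Real.sin p.2) with hf
  set g : ℝ × ℝ → ℝ := fun p => Y (polarMap p) * Real.cos p.2 - X (polarMap p) * Real.sin p.2
    with hg
  have hcos : ∀ p : ℝ × ℝ, HasFDerivAt (fun p : ℝ × ℝ => Real.cos p.2)
      (-Real.sin p.2 • ContinuousLinearMap.snd ℝ ℝ ℝ) p := fun p => hasFDerivAt_snd.cos
  have hsin : ∀ p : ℝ × ℝ, HasFDerivAt (fun p : ℝ × ℝ => Real.sin p.2)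
      (Real.cos p.2 • ContinuousLinearMap.snd ℝ ℝ ℝ) p := fun p => hasFDerivAt_snd.sin
  have hf' : ∀ p ∈ Set.Icc ((0 : ℝ), -Real.pi) (1, Real.pi), HasFDerivAt f _ p := fun p hp =>
    hasFDerivAt_fst.mul (((hd X hX p hp).mul (hcos p)).add ((hd Y hY p hp).mul (hsin p)))
  have hg' : ∀ p ∈ Set.Icc ((0 : ℝ), -Real.pi) (1, Real.pi), HasFDerivAt g _ p := fun p hp =>
    ((hd Y hY p hp).mul (hcos p)).sub ((hd X hX p hp).mul (hsin p))
  have key : ∀ p ∈ Set.Icc ((0 : ℝ), -Real.pi) (1, Real.pi),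
      fderiv ℝ f p (1, 0) + fderiv ℝ g p (0, 1) =
        p.1 * (fderiv ℝ X (polarMap p) 1 + fderiv ℝ Y (polarMap p) Complex.I) := by
    intro p hp
    rw [(hf' p hp).fderiv, (hg' p hp).fderiv]
    simp only [add_apply, sub_apply,
      smul_apply, ContinuousLinearMap.comp_apply,
      ContinuousLinearMap.smulRight_apply, ContinuousLinearMap.coe_fst',
      ContinuousLinearMap.coe_snd', smul_eq_mul]
    have h1 := Real.sin_sq_add_cos_sq p.2
    have hp1 : (1 : ℝ) • Complex.exp (Complex.I * p.2) +
        (0 : ℝ) • ((p.1 : ℂ) * (Complex.I * Complex.exp (Complex.I * p.2))) =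
        Real.cos p.2 • (1 : ℂ) + Real.sin p.2 • Complex.I := by
      simp [exp_I_mul_eq]
    have hp2 : (0 : ℝ) • Complex.exp (Complex.I * p.2) +
        (1 : ℝ) • ((p.1 : ℂ) * (Complex.I * Complex.exp (Complex.I * p.2))) =
        (-(p.1 * Real.sin p.2)) • (1 : ℂ) + (p.1 * Real.cos p.2) • Complex.I := by
      apply Complex.ext <;> simp [exp_I_mul_eq]
    rw [hp1, hp2]
    simp only [map_add, map_smul, smul_eq_mul]
    linear_combination (p.1 * (fderiv ℝ X (polarMap p) 1 + fderiv ℝ Y (polarMap p) Complex.I)) * h1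
  have hcont : ContinuousOn (fun p : ℝ × ℝ => p.1 * (fderiv ℝ X (polarMap p) 1 +
      fderiv ℝ Y (polarMap p) Complex.I)) (Set.Icc ((0 : ℝ), -Real.pi) (1, Real.pi)) :=
    continuous_fst.continuousOn.mul ((hc X hX 1).add (hc Y hY Complex.I))
  have hsub : Set.Ioo (0 : ℝ) 1 ×ˢ Set.Ioo (-Real.pi) Real.pi ⊆
      Set.Icc ((0 : ℝ), -Real.pi) (1, Real.pi) := by
    rw [← Set.Icc_prod_Icc]
    exact Set.prod_mono Set.Ioo_subset_Icc_self Set.Ioo_subset_Icc_self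
  have hpi := Real.pi_pos
  rw [← setIntegral_congr_fun measurableSet_Icc key,
    integral_divergence_prod_Icc_of_hasFDerivAt_of_le f g (fderiv ℝ f) (fderiv ℝ g)
      ((0 : ℝ), -Real.pi) (1, Real.pi) ⟨zero_le_one, by simp; linarith⟩
      (fun p hp => (hf' p hp).continuousAt.continuousWithinAt)
      (fun p hp => (hg' p hp).continuousAt.continuousWithinAt)
      (fun p hp => (hf' p (hsub hp)).differentiableAt.hasFDerivAt)
      (fun p hp => (hg' p (hsub hp)).differentiableAt.hasFDerivAt)
      ((hcont.congr key).integrableOn_compact isCompact_Icc)]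
  have hgpi : ∀ x, g (x, Real.pi) = g (x, -Real.pi) := by
    intro x
    simp [hg, polarMap, exp_I_mul_eq]
  have hper : Function.Periodic (fun θ : ℝ => X (Complex.exp (Complex.I * θ)) * Real.cos θ +
        Y (Complex.exp (Complex.I * θ)) * Real.sin θ) (2 * Real.pi) := by
    intro θ
    simp only [exp_I_mul_eq, Real.cos_add_two_pi, Real.sin_add_two_pi]
  have := hper.intervalIntegral_add_eq (-Real.pi) 0
  rw [show -Real.pi + 2 * Real.pi = Real.pi by ring, zero_add] at this
  rw [← this]
  simp [hgpi, hf, polarMap]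
/-- The outward normal derivative of `φ` at `e^{iθ}`. -/
noncomputable def normalDeriv (φ : ℂ → ℝ) (θ : ℝ) : ℝ :=
  pd1R φ (Complex.exp (Complex.I * θ)) * Real.cos θ +
    pd2R φ (Complex.exp (Complex.I * θ)) * Real.sin θ

theorem contDiffOn_fderiv_apply {φ : ℂ → ℝ} {U : Set ℂ} (hU : IsOpen U)
    (hφ : ContDiffOn ℝ (⊤ : ℕ∞) φ U) (v : ℂ) :
    ContDiffOn ℝ 1 (fun z => fderiv ℝ φ z v) U :=
  (hφ.fderiv_of_isOpen hU (m := 1) (by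
    rw [one_add_one_eq_two]; exact WithTop.coe_le_coe.2 (le_top : (2 : ℕ∞) ≤ ⊤))).clm_apply contDiffOn_const

theorem integral_Bf {φ : ℂ → ℝ} {U : Set ℂ} (hU : IsOpen U)
    (hDU : Metric.closedBall (0 : ℂ) 1 ⊆ U) (hφ : ContDiffOn ℝ (⊤ : ℕ∞) φ U) :
    ∫ z in Metric.ball (0 : ℂ) 1, Bf φ z = ∫ θ in (0 : ℝ)..(2 * Real.pi), normalDeriv φ θ :=
  integral_ball_divergence hU hDU (contDiffOn_fderiv_apply hU hφ 1)
    (contDiffOn_fderiv_apply hU hφ Complex.I)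

theorem hasFDerivAt_eval_re (q : Polynomial ℂ) (z : ℂ) :
    HasFDerivAt (fun z => (q.eval z).re)
      (Complex.reCLM.comp ((ContinuousLinearMap.toSpanSingleton ℂ
        (q.derivative.eval z)).restrictScalars ℝ)) z :=
  Complex.reCLM.hasFDerivAt.comp z ((q.hasDerivAt z).hasFDerivAt.restrictScalars ℝ)

theorem hasFDerivAt_eval_im (q : Polynomial ℂ) (z : ℂ) :
    HasFDerivAt (fun z => (q.eval z).im)
      (Complex.imCLM.comp ((ContinuousLinearMap.toSpanSingleton ℂ
        (q.derivative.eval z)).restrictScalars ℝ)) z :=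
  Complex.imCLM.hasFDerivAt.comp z ((q.hasDerivAt z).hasFDerivAt.restrictScalars ℝ)

/-- Half of the first partial derivative of `|e^{-φ} q|²`. -/
noncomputable def gradX (φ : ℂ → ℝ) (q : Polynomial ℂ) (z : ℂ) : ℝ :=
  Real.exp (-2 * φ z) * ((q.derivative.eval z).re * (q.eval z).re +
    (q.derivative.eval z).im * (q.eval z).im -
    pd1R φ z * ((q.eval z).re * (q.eval z).re + (q.eval z).im * (q.eval z).im))

/-- Half of the second partial derivative of `|e^{-φ} q|²`. -/
noncomputable def gradY (φ : ℂ → ℝ) (q : Polynomial ℂ) (z : ℂ) : ℝ :=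
  Real.exp (-2 * φ z) * ((q.derivative.eval z).re * (q.eval z).im -
    (q.derivative.eval z).im * (q.eval z).re -
    pd2R φ z * ((q.eval z).re * (q.eval z).re + (q.eval z).im * (q.eval z).im))

theorem contDiff_eval_re (q : Polynomial ℂ) : ContDiff ℝ 1 (fun z => (q.eval z).re) :=
  Complex.reCLM.contDiff.comp ((Polynomial.contDiff_aeval q 1).restrict_scalars ℝ)

theorem contDiff_eval_im (q : Polynomial ℂ) : ContDiff ℝ 1 (fun z => (q.eval z).im) :=
  Complex.imCLM.contDiff.comp ((Polynomial.contDiff_aeval q 1).restrict_scalars ℝ)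

theorem contDiffOn_gradX {φ : ℂ → ℝ} {U : Set ℂ} (hU : IsOpen U)
    (hφ : ContDiffOn ℝ (⊤ : ℕ∞) φ U) (q : Polynomial ℂ) : ContDiffOn ℝ 1 (gradX φ q) U := by
  have h1 : ContDiffOn ℝ 1 φ U := hφ.of_le (by exact_mod_cast le_top)
  have h2 : ContDiffOn ℝ 1 (pd1R φ) U := contDiffOn_fderiv_apply hU hφ 1
  have a := (contDiff_eval_re q).contDiffOn (s := U)
  have b := (contDiff_eval_im q).contDiffOn (s := U)
  have a' := (contDiff_eval_re q.derivative).contDiffOn (s := U)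
  have b' := (contDiff_eval_im q.derivative).contDiffOn (s := U)
  exact (contDiffOn_const.mul h1).exp.mul
    (((a'.mul a).add (b'.mul b)).sub (h2.mul ((a.mul a).add (b.mul b))))

theorem contDiffOn_gradY {φ : ℂ → ℝ} {U : Set ℂ} (hU : IsOpen U)
    (hφ : ContDiffOn ℝ (⊤ : ℕ∞) φ U) (q : Polynomial ℂ) : ContDiffOn ℝ 1 (gradY φ q) U := by
  have h1 : ContDiffOn ℝ 1 φ U := hφ.of_le (by exact_mod_cast le_top)
  have h2 : ContDiffOn ℝ 1 (pd2R φ) U := contDiffOn_fderiv_apply hU hφ Complex.I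
  have a := (contDiff_eval_re q).contDiffOn (s := U)
  have b := (contDiff_eval_im q).contDiffOn (s := U)
  have a' := (contDiff_eval_re q.derivative).contDiffOn (s := U)
  have b' := (contDiff_eval_im q.derivative).contDiffOn (s := U)
  exact (contDiffOn_const.mul h1).exp.mul
    (((a'.mul b).sub (b'.mul a)).sub (h2.mul ((a.mul a).add (b.mul b))))

theorem form_density_eq_divergence {φ : ℂ → ℝ} {U : Set ℂ} (hU : IsOpen U)
    (hφ : ContDiffOn ℝ (⊤ : ℕ∞) φ U) (q : Polynomial ℂ) {z : ℂ} (hz : z ∈ U) :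
    ‖mag1 φ (fun z => Complex.exp (-(φ z : ℂ)) * q.eval z) z‖ ^ 2 +
      ‖mag2 φ (fun z => Complex.exp (-(φ z : ℂ)) * q.eval z) z‖ ^ 2 -
      Bf φ z * ‖Complex.exp (-(φ z : ℂ)) * q.eval z‖ ^ 2 =
    fderiv ℝ (gradX φ q) z 1 + fderiv ℝ (gradY φ q) z Complex.I := by
  have hφz : HasFDerivAt φ (fderiv ℝ φ z) z :=
    ((hφ.differentiableOn (by simp)).differentiableAt (hU.mem_nhds hz)).hasFDerivAt
  have h1 : HasFDerivAt (pd1R φ) (fderiv ℝ (pd1R φ) z) z :=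
    (((contDiffOn_fderiv_apply hU hφ 1).differentiableOn one_ne_zero).differentiableAt
      (hU.mem_nhds hz)).hasFDerivAt
  have h2 : HasFDerivAt (pd2R φ) (fderiv ℝ (pd2R φ) z) z :=
    (((contDiffOn_fderiv_apply hU hφ Complex.I).differentiableOn one_ne_zero).differentiableAt
      (hU.mem_nhds hz)).hasFDerivAt
  have a := hasFDerivAt_eval_re q z
  have b := hasFDerivAt_eval_im q z
  have a' := hasFDerivAt_eval_re q.derivative z
  have b' := hasFDerivAt_eval_im q.derivative z
  have hX : HasFDerivAt (gradX φ q) _ z := (hφz.const_mul (-2)).exp.mul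
    (((a'.mul a).add (b'.mul b)).sub (h1.mul ((a.mul a).add (b.mul b))))
  have hY : HasFDerivAt (gradY φ q) _ z := (hφz.const_mul (-2)).exp.mul
    (((a'.mul b).sub (b'.mul a)).sub (h2.mul ((a.mul a).add (b.mul b))))
  have hu : HasFDerivAt (fun z => Complex.exp (-(φ z : ℂ)) * q.eval z) _ z :=
    (Complex.ofRealCLM.hasFDerivAt.comp z hφz).neg.cexp.mul
      ((q.hasDerivAt z).hasFDerivAt.restrictScalars ℝ)
  have hexp : Complex.exp (-(φ z : ℂ)) = (Real.exp (-φ z) : ℝ) := by push_cast; rfl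
  have hexp2 : Real.exp (-2 * φ z) = Real.exp (-φ z) ^ 2 := by
    rw [← Real.exp_nat_mul]; congr 1; push_cast; ring
  rw [hX.fderiv, hY.fderiv]
  simp only [mag1, mag2, pd1, pd2, hu.fderiv, A1f, A2f, Bf, ← Complex.normSq_eq_norm_sq]
  have e1 : fderiv ℝ φ z 1 = pd1R φ z := rfl
  have e2 : fderiv ℝ φ z Complex.I = pd2R φ z := rfl
  have e3 : fderiv ℝ (pd1R φ) z 1 = pd1R (pd1R φ) z := rfl
  have e4 : fderiv ℝ (pd2R φ) z Complex.I = pd2R (pd2R φ) z := rfl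
  simp only [Function.comp_apply, Complex.ofRealCLM_apply, Pi.neg_apply, hexp, hexp2]
  generalize Real.exp (-φ z) = E
  simp [e1, e2, e3, e4, Complex.normSq_apply]
  ring

theorem qform_exp_mul_eval {φ : ℂ → ℝ} {U : Set ℂ} (hU : IsOpen U)
    (hDU : Metric.closedBall (0 : ℂ) 1 ⊆ U) (hφ : ContDiffOn ℝ (⊤ : ℕ∞) φ U)
    (hφ0 : ∀ z : ℂ, ‖z‖ = 1 → φ z = 0) {g : ℝ → ℝ} (hg : Continuous g) (q : Polynomial ℂ) :
    qform φ g (fun z => Complex.exp (-(φ z : ℂ)) * q.eval z) =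
      ∫ θ in (0 : ℝ)..(2 * Real.pi),
        ((Complex.exp (Complex.I * θ) * q.derivative.eval (Complex.exp (Complex.I * θ)) *
          (starRingEnd ℂ) (q.eval (Complex.exp (Complex.I * θ)))).re -
        (normalDeriv φ θ - g θ) * ‖q.eval (Complex.exp (Complex.I * θ))‖ ^ 2) := by
  have hnorm : ∀ θ : ℝ, ‖Complex.exp (Complex.I * θ)‖ = 1 := fun θ => by
    rw [mul_comm, Complex.norm_exp_ofReal_mul_I]
  have hcont : Continuous fun θ : ℝ => Complex.exp (Complex.I * θ) := by fun_prop
  have hmem : ∀ θ : ℝ, Complex.exp (Complex.I * θ) ∈ U := fun θ =>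
    hDU (by rw [mem_closedBall_zero_iff, hnorm])
  rw [qform, setIntegral_congr_fun Metric.isOpen_ball.measurableSet fun z hz =>
      form_density_eq_divergence hU hφ q (hDU (Metric.ball_subset_closedBall hz)),
    integral_ball_divergence hU hDU (contDiffOn_gradX hU hφ q) (contDiffOn_gradY hU hφ q),
    ← intervalIntegral.integral_add]
  · refine intervalIntegral.integral_congr fun θ _ => ?_
    have h0 := hφ0 _ (hnorm θ)
    simp only [gradX, gradY, normalDeriv, h0]
    have hre : (Complex.exp (Complex.I * θ)).re = Real.cos θ := by
      rw [mul_comm, Complex.exp_ofReal_mul_I_re]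
    have him : (Complex.exp (Complex.I * θ)).im = Real.sin θ := by
      rw [mul_comm, Complex.exp_ofReal_mul_I_im]
    generalize Complex.exp (Complex.I * θ) = w at hre him
    simp [← Complex.normSq_eq_norm_sq, Complex.normSq_apply, hre, him]
    ring
  · refine Continuous.intervalIntegrable ?_ _ _
    exact (((contDiffOn_gradX hU hφ q).continuousOn.comp_continuous hcont hmem).mul
      Real.continuous_cos).add
      (((contDiffOn_gradY hU hφ q).continuousOn.comp_continuous hcont hmem).mul
      Real.continuous_sin)
  · refine Continuous.intervalIntegrable ?_ _ _
    have : Continuous fun θ : ℝ => φ (Complex.exp (Complex.I * θ)) :=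
      hφ.continuousOn.comp_continuous hcont hmem
    have hq : Continuous fun θ : ℝ => q.eval (Complex.exp (Complex.I * θ)) :=
      q.continuous.comp hcont
    exact hg.mul (((Complex.continuous_ofReal.comp this).neg.cexp.mul hq).norm.pow 2)

theorem continuous_normalDeriv {φ : ℂ → ℝ} {U : Set ℂ} (hU : IsOpen U)
    (hDU : Metric.closedBall (0 : ℂ) 1 ⊆ U) (hφ : ContDiffOn ℝ (⊤ : ℕ∞) φ U) :
    Continuous (normalDeriv φ) := by
  have hcont : Continuous fun θ : ℝ => Complex.exp (Complex.I * θ) := by fun_prop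
  have hmem : ∀ θ : ℝ, Complex.exp (Complex.I * θ) ∈ U := fun θ =>
    hDU (by rw [mem_closedBall_zero_iff, mul_comm, Complex.norm_exp_ofReal_mul_I])
  exact (((contDiffOn_fderiv_apply hU hφ 1).continuousOn.comp_continuous hcont hmem).mul
      Real.continuous_cos).add
      (((contDiffOn_fderiv_apply hU hφ Complex.I).continuousOn.comp_continuous hcont hmem).mul
      Real.continuous_sin)

theorem normalDeriv_periodic (φ : ℂ → ℝ) : Function.Periodic (normalDeriv φ) (2 * Real.pi) := by
  intro θ
  simp only [normalDeriv, exp_I_mul_eq, Real.cos_add_two_pi, Real.sin_add_two_pi]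

theorem integral_exp_pow_mul_conj_exp_pow (k l : ℕ) :
    ∫ θ in (0 : ℝ)..(2 * Real.pi), Complex.exp (Complex.I * θ) ^ k *
      (starRingEnd ℂ) (Complex.exp (Complex.I * θ) ^ l) =
        if k = l then (2 * Real.pi : ℂ) else 0 := by
  have h : ∀ θ : ℝ, Complex.exp (Complex.I * θ) ^ k *
      (starRingEnd ℂ) (Complex.exp (Complex.I * θ) ^ l) =
      Complex.exp ((((k : ℤ) - l : ℤ) * Complex.I) * θ) := by
    intro θ
    rw [← Complex.exp_nat_mul, ← Complex.exp_nat_mul, ← Complex.exp_conj, ← Complex.exp_add]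
    congr 1
    simp
    ring
  simp only [h]
  split_ifs with hkl
  · subst hkl
    simp
  · have hne : (((k : ℤ) - l : ℤ) : ℂ) * Complex.I ≠ 0 :=
      mul_ne_zero (Int.cast_ne_zero.2 (sub_ne_zero.2 (by exact_mod_cast hkl))) Complex.I_ne_zero
    rw [integral_exp_mul_complex hne]
    have : Complex.exp ((((k : ℤ) - l : ℤ) : ℂ) * Complex.I * ((2 * Real.pi : ℝ) : ℂ)) = 1 := by
      rw [Complex.exp_eq_one_iff]
      exact ⟨(k : ℤ) - l, by push_cast; ring⟩
    rw [this]
    simp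

theorem continuous_eval_exp (q : Polynomial ℂ) :
    Continuous fun θ : ℝ => q.eval (Complex.exp (Complex.I * θ)) :=
  q.continuous.comp (by fun_prop)

/-- Parseval's identity for polynomials on the unit circle. -/
theorem integral_eval_mul_conj_eval (A B : Polynomial ℂ) {n : ℕ} (hA : A.natDegree < n)
    (hB : B.natDegree < n) :
    ∫ θ in (0 : ℝ)..(2 * Real.pi), A.eval (Complex.exp (Complex.I * θ)) *
      (starRingEnd ℂ) (B.eval (Complex.exp (Complex.I * θ))) =
      2 * Real.pi * ∑ k ∈ Finset.range n, A.coeff k * (starRingEnd ℂ) (B.coeff k) := by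
  have hint : ∀ k l : ℕ, IntervalIntegrable (fun θ : ℝ => A.coeff k * (starRingEnd ℂ) (B.coeff l) *
      (Complex.exp (Complex.I * θ) ^ k * (starRingEnd ℂ) (Complex.exp (Complex.I * θ) ^ l)))
      volume 0 (2 * Real.pi) := by
    intro k l
    refine Continuous.intervalIntegrable ?_ _ _
    have : Continuous fun θ : ℝ => (starRingEnd ℂ) (Complex.exp (Complex.I * θ) ^ l) :=
      Complex.continuous_conj.comp (by fun_prop)
    fun_prop
  have h : ∀ θ : ℝ, A.eval (Complex.exp (Complex.I * θ)) *
      (starRingEnd ℂ) (B.eval (Complex.exp (Complex.I * θ))) =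
      ∑ k ∈ Finset.range n, ∑ l ∈ Finset.range n, A.coeff k * (starRingEnd ℂ) (B.coeff l) *
        (Complex.exp (Complex.I * θ) ^ k * (starRingEnd ℂ) (Complex.exp (Complex.I * θ) ^ l)) := by
    intro θ
    rw [Polynomial.eval_eq_sum_range' hA, Polynomial.eval_eq_sum_range' hB, map_sum,
      Finset.sum_mul_sum]
    refine Finset.sum_congr rfl fun k _ => Finset.sum_congr rfl fun l _ => ?_
    rw [map_mul]
    ring
  simp only [h]
  rw [intervalIntegral.integral_finsetSum fun k _ => ?_, Finset.mul_sum]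
  · refine Finset.sum_congr rfl fun k hk => ?_
    rw [intervalIntegral.integral_finsetSum fun l _ => hint k l]
    simp only [intervalIntegral.integral_const_mul, integral_exp_pow_mul_conj_exp_pow, mul_ite,
      mul_zero, Finset.sum_ite_eq, if_pos hk]
    ring
  · have := IntervalIntegrable.sum (Finset.range n) fun l _ => hint k l
    simpa only [Finset.sum_fn] using this

theorem integral_re_eq {f : ℝ → ℂ} (hf : Continuous f) :
    ∫ θ in (0 : ℝ)..(2 * Real.pi), (f θ).re = (∫ θ in (0 : ℝ)..(2 * Real.pi), f θ).re := by
  have := Complex.reCLM.intervalIntegral_comp_comm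
    (hf.intervalIntegrable (μ := volume) 0 (2 * Real.pi))
  simpa using this

theorem continuous_conj_eval_exp (q : Polynomial ℂ) :
    Continuous fun θ : ℝ => (starRingEnd ℂ) (q.eval (Complex.exp (Complex.I * θ))) :=
  Complex.continuous_conj.comp (continuous_eval_exp q)

theorem integral_norm_sq_eval (S : Polynomial ℂ) {n : ℕ} (hS : S.natDegree < n) :
    ∫ θ in (0 : ℝ)..(2 * Real.pi), ‖S.eval (Complex.exp (Complex.I * θ))‖ ^ 2 =
      2 * Real.pi * ∑ k ∈ Finset.range n, ‖S.coeff k‖ ^ 2 := by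
  have h : ∀ z : ℂ, ‖z‖ ^ 2 = (z * (starRingEnd ℂ) z).re := fun z => by
    rw [Complex.mul_conj, Complex.ofReal_re, Complex.normSq_eq_norm_sq]
  simp only [h]
  have hc : Continuous fun θ : ℝ => S.eval (Complex.exp (Complex.I * θ)) *
      (starRingEnd ℂ) (S.eval (Complex.exp (Complex.I * θ))) :=
    (continuous_eval_exp S).mul (continuous_conj_eval_exp S)
  rw [integral_re_eq hc, integral_eval_mul_conj_eval S S hS hS, ← Complex.re_sum]
  simp [Complex.mul_re]

theorem integral_norm_sq_eval_pos {S : Polynomial ℂ} (hS : S ≠ 0) :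
    0 < ∫ θ in (0 : ℝ)..(2 * Real.pi), ‖S.eval (Complex.exp (Complex.I * θ))‖ ^ 2 := by
  rw [integral_norm_sq_eval S (Nat.lt_succ_self _)]
  refine mul_pos Real.two_pi_pos (Finset.sum_pos' (fun _ _ => by positivity)
    ⟨S.natDegree, by simp, ?_⟩)
  have : S.coeff S.natDegree ≠ 0 := by simpa using hS
  positivity

theorem integral_re_eval (G : Polynomial ℂ) :
    ∫ θ in (0 : ℝ)..(2 * Real.pi), (G.eval (Complex.exp (Complex.I * θ))).re =
      2 * Real.pi * (G.coeff 0).re := by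
  rw [integral_re_eq (continuous_eval_exp G)]
  have := integral_eval_mul_conj_eval G 1 (n := G.natDegree + 1) (by simp) (by simp)
  simp only [Polynomial.eval_one, map_one, mul_one, Polynomial.coeff_one] at this
  rw [this]
  simp

/-- The quadratic form of `-i d/dθ` on analytic polynomials of degree at most `d`. -/
theorem integral_re_derivative_le (S : Polynomial ℂ) {d : ℕ} (hS : S.natDegree ≤ d) :
    ∫ θ in (0 : ℝ)..(2 * Real.pi), (Complex.exp (Complex.I * θ) *
      S.derivative.eval (Complex.exp (Complex.I * θ)) *
      (starRingEnd ℂ) (S.eval (Complex.exp (Complex.I * θ)))).re ≤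
    d * ∫ θ in (0 : ℝ)..(2 * Real.pi), ‖S.eval (Complex.exp (Complex.I * θ))‖ ^ 2 := by
  have h0 : (Polynomial.X * S.derivative).natDegree ≤ d := by
    rcases Nat.eq_zero_or_pos S.natDegree with h | h
    · rw [Polynomial.natDegree_eq_zero.1 h |>.choose_spec.symm]
      simp
    · refine Polynomial.natDegree_mul_le.trans ?_
      have := Polynomial.natDegree_derivative_lt h.ne'
      simp only [Polynomial.natDegree_X]
      omega
  have h1 := integral_eval_mul_conj_eval (Polynomial.X * S.derivative) S
    (Nat.lt_succ_of_le h0) (Nat.lt_succ_of_le hS)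
  simp only [Polynomial.eval_mul, Polynomial.eval_X] at h1
  rw [integral_re_eq, h1, integral_norm_sq_eval S (Nat.lt_succ_of_le hS)]
  · rw [mul_left_comm, ← Complex.ofReal_ofNat, ← Complex.ofReal_mul, Complex.re_ofReal_mul,
      Complex.re_sum, Finset.mul_sum (a := (d : ℝ))]
    refine mul_le_mul_of_nonneg_left (Finset.sum_le_sum fun k hk => ?_) Real.two_pi_pos.le
    have hk' : (k : ℝ) ≤ d := by exact_mod_cast Nat.lt_succ_iff.1 (Finset.mem_range.1 hk)
    have hc : ((Polynomial.X * S.derivative).coeff k) = k * S.coeff k := by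
      cases k with
      | zero => simp
      | succ k => rw [Polynomial.coeff_X_mul, Polynomial.coeff_derivative]; push_cast; ring
    rw [hc, mul_assoc, Complex.mul_conj, Complex.normSq_eq_norm_sq]
    norm_cast
    exact mul_le_mul_of_nonneg_right hk' (by positivity)
  · exact ((by fun_prop : Continuous fun θ : ℝ => Complex.exp (Complex.I * θ)).mul
      (continuous_eval_exp _)).mul (continuous_conj_eval_exp S)

/-- The polynomial which equals `z ^ P.natDegree * conj (P z)` on the unit circle. -/
noncomputable def conjReverse (P : Polynomial ℂ) : Polynomial ℂ :=
  ∑ k ∈ Finset.range (P.natDegree + 1),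
    Polynomial.C ((starRingEnd ℂ) (P.coeff k)) * Polynomial.X ^ (P.natDegree - k)

theorem natDegree_conjReverse_le (P : Polynomial ℂ) :
    (conjReverse P).natDegree ≤ P.natDegree :=
  Polynomial.natDegree_sum_le_of_forall_le _ _ fun _ _ =>
    (Polynomial.natDegree_C_mul_X_pow_le _ _).trans (Nat.sub_le _ _)

theorem pow_sub_eq_of_norm_eq_one {z : ℂ} (hz : ‖z‖ = 1) {k M : ℕ} (hk : k ≤ M) :
    z ^ (M - k) = z ^ M * (starRingEnd ℂ) z ^ k := by
  have h : z * (starRingEnd ℂ) z = 1 := by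
    rw [Complex.mul_conj, Complex.normSq_eq_norm_sq, hz]; simp
  conv_rhs => rw [← Nat.sub_add_cancel hk, pow_add, mul_assoc, ← mul_pow, h, one_pow, mul_one]

theorem eval_conjReverse (P : Polynomial ℂ) {z : ℂ} (hz : ‖z‖ = 1) :
    (conjReverse P).eval z = z ^ P.natDegree * (starRingEnd ℂ) (P.eval z) := by
  rw [conjReverse, Polynomial.eval_finsetSum, Polynomial.eval_eq_sum_range, map_sum,
    Finset.mul_sum]
  refine Finset.sum_congr rfl fun k hk => ?_
  simp only [Polynomial.eval_mul, Polynomial.eval_C, Polynomial.eval_pow, Polynomial.eval_X,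
    pow_sub_eq_of_norm_eq_one hz (Nat.lt_succ_iff.1 (Finset.mem_range.1 hk)), map_mul, map_pow]
  ring

theorem mul_eval_derivative_conjReverse (P : Polynomial ℂ) {z : ℂ} (hz : ‖z‖ = 1) :
    z * (conjReverse P).derivative.eval z =
      z ^ P.natDegree * (P.natDegree * (starRingEnd ℂ) (P.eval z) -
        (starRingEnd ℂ) (z * P.derivative.eval z)) := by
  have hd : z * P.derivative.eval z =
      ∑ k ∈ Finset.range (P.natDegree + 1), (k : ℂ) * P.coeff k * z ^ k := by
    rw [Polynomial.derivative_eval, Polynomial.sum_over_range _ (by simp), Finset.mul_sum]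
    refine Finset.sum_congr rfl fun k _ => ?_
    cases k with
    | zero => simp
    | succ k => simp [pow_succ]; ring
  rw [hd, Polynomial.eval_eq_sum_range (p := P), map_sum, map_sum, Finset.mul_sum,
    ← Finset.sum_sub_distrib, Finset.mul_sum, conjReverse, Polynomial.derivative_sum,
    Polynomial.eval_finsetSum, Finset.mul_sum]
  refine Finset.sum_congr rfl fun k hk => ?_
  have hk' := Nat.lt_succ_iff.1 (Finset.mem_range.1 hk)
  have h : z * ((P.natDegree - k : ℕ) * z ^ (P.natDegree - k - 1)) =
      (P.natDegree - k) * (z ^ P.natDegree * (starRingEnd ℂ) z ^ k) := by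
    rw [← pow_sub_eq_of_norm_eq_one hz hk', ← Nat.cast_sub hk']
    cases P.natDegree - k with
    | zero => simp
    | succ m => simp [pow_succ]; ring
  simp only [Polynomial.derivative_C_mul, Polynomial.derivative_X_pow, Polynomial.eval_mul,
    Polynomial.eval_C, Polynomial.eval_pow, Polynomial.eval_X, map_mul, map_pow,
    Polynomial.eval_natCast, map_natCast]
  linear_combination (starRingEnd ℂ) (P.coeff k) * h

theorem integral_form_neg {V : ℝ → ℝ} (hV : Continuous V) {P q : Polynomial ℂ} {lam : ℝ} {d : ℕ}
    (hP : P ≠ 0) (hq : q ≠ 0) (hqd : q.natDegree ≤ d) (hd : (d : ℝ) < lam)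
    (h : ∀ θ : ℝ, lam * ‖P.eval (Complex.exp (Complex.I * θ))‖ ^ 2 +
      2 * (Complex.exp (Complex.I * θ) * P.derivative.eval (Complex.exp (Complex.I * θ)) *
        (starRingEnd ℂ) (P.eval (Complex.exp (Complex.I * θ)))).re ≤
      V θ * ‖P.eval (Complex.exp (Complex.I * θ))‖ ^ 2) :
    ∫ θ in (0 : ℝ)..(2 * Real.pi),
        ((Complex.exp (Complex.I * θ) * (P * q).derivative.eval (Complex.exp (Complex.I * θ)) *
          (starRingEnd ℂ) ((P * q).eval (Complex.exp (Complex.I * θ)))).re -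
        V θ * ‖(P * q).eval (Complex.exp (Complex.I * θ))‖ ^ 2) < 0 := by
  have hexp : Continuous fun θ : ℝ => Complex.exp (Complex.I * θ) := by fun_prop
  have hz : ∀ θ : ℝ, ‖Complex.exp (Complex.I * θ)‖ = 1 := fun θ => by
    rw [mul_comm, Complex.norm_exp_ofReal_mul_I]
  set S := conjReverse P * q
  have hSd : S.natDegree ≤ P.natDegree + d :=
    Polynomial.natDegree_mul_le.trans (add_le_add (natDegree_conjReverse_le P) hqd)
  have hnorm : ∀ θ : ℝ, ‖S.eval (Complex.exp (Complex.I * θ))‖ ^ 2 =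
      ‖(P * q).eval (Complex.exp (Complex.I * θ))‖ ^ 2 := by
    intro θ
    simp [S, eval_conjReverse P (hz θ), hz θ]
  have hre : ∀ p : Polynomial ℂ, Continuous fun θ : ℝ => (Complex.exp (Complex.I * θ) *
      p.derivative.eval (Complex.exp (Complex.I * θ)) *
      (starRingEnd ℂ) (p.eval (Complex.exp (Complex.I * θ)))).re := fun p =>
    Complex.continuous_re.comp ((hexp.mul (continuous_eval_exp _)).mul (continuous_conj_eval_exp p))
  have hn : ∀ p : Polynomial ℂ, Continuous fun θ : ℝ =>
      ‖p.eval (Complex.exp (Complex.I * θ))‖ ^ 2 := fun p => (continuous_eval_exp p).norm.pow 2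
  have hpt : ∀ θ : ℝ, (Complex.exp (Complex.I * θ) *
        (P * q).derivative.eval (Complex.exp (Complex.I * θ)) *
          (starRingEnd ℂ) ((P * q).eval (Complex.exp (Complex.I * θ)))).re -
        V θ * ‖(P * q).eval (Complex.exp (Complex.I * θ))‖ ^ 2 ≤
      (Complex.exp (Complex.I * θ) * S.derivative.eval (Complex.exp (Complex.I * θ)) *
          (starRingEnd ℂ) (S.eval (Complex.exp (Complex.I * θ)))).re -
        (P.natDegree + lam) * ‖S.eval (Complex.exp (Complex.I * θ))‖ ^ 2 := by
    intro θ
    have hR := eval_conjReverse P (hz θ)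
    have hR' := mul_eval_derivative_conjReverse P (hz θ)
    have hw1 : Complex.exp (Complex.I * θ) ^ P.natDegree *
        (starRingEnd ℂ) (Complex.exp (Complex.I * θ) ^ P.natDegree) = 1 := by
      rw [Complex.mul_conj, Complex.normSq_eq_norm_sq, norm_pow, hz]; simp
    have hS : Complex.exp (Complex.I * θ) * S.derivative.eval (Complex.exp (Complex.I * θ)) *
          (starRingEnd ℂ) (S.eval (Complex.exp (Complex.I * θ))) =
        (P.natDegree * (starRingEnd ℂ) (P.eval (Complex.exp (Complex.I * θ))) -
        (starRingEnd ℂ) (Complex.exp (Complex.I * θ) *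
          P.derivative.eval (Complex.exp (Complex.I * θ)))) *
          P.eval (Complex.exp (Complex.I * θ)) *
          (q.eval (Complex.exp (Complex.I * θ)) *
            (starRingEnd ℂ) (q.eval (Complex.exp (Complex.I * θ)))) +
        (starRingEnd ℂ) (P.eval (Complex.exp (Complex.I * θ))) *
          P.eval (Complex.exp (Complex.I * θ)) *
          (Complex.exp (Complex.I * θ) * q.derivative.eval (Complex.exp (Complex.I * θ)) *
            (starRingEnd ℂ) (q.eval (Complex.exp (Complex.I * θ)))) := by
      simp only [S, Polynomial.derivative_mul, Polynomial.eval_add, Polynomial.eval_mul, mul_add,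
        ← mul_assoc, hR', hR, map_mul, Complex.conj_conj] at hw1 ⊢
      generalize Complex.exp (Complex.I * θ) ^ P.natDegree = w at hw1 ⊢
      linear_combination ((P.natDegree * (starRingEnd ℂ) (P.eval (Complex.exp (Complex.I * θ))) -
        (starRingEnd ℂ) (Complex.exp (Complex.I * θ)) *
          (starRingEnd ℂ) (P.derivative.eval (Complex.exp (Complex.I * θ)))) *
          P.eval (Complex.exp (Complex.I * θ)) *
          (q.eval (Complex.exp (Complex.I * θ)) *
            (starRingEnd ℂ) (q.eval (Complex.exp (Complex.I * θ)))) +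
        (starRingEnd ℂ) (P.eval (Complex.exp (Complex.I * θ))) *
          P.eval (Complex.exp (Complex.I * θ)) *
          (Complex.exp (Complex.I * θ) * q.derivative.eval (Complex.exp (Complex.I * θ)) *
            (starRingEnd ℂ) (q.eval (Complex.exp (Complex.I * θ))))) * hw1
    have hq2 : 0 ≤ ‖q.eval (Complex.exp (Complex.I * θ))‖ ^ 2 := by positivity
    have hh := mul_le_mul_of_nonneg_right (h θ) hq2
    rw [hnorm, hS]
    simp only [Polynomial.derivative_mul, Polynomial.eval_add, Polynomial.eval_mul]
    simp only [norm_mul, mul_pow, ← Complex.normSq_eq_norm_sq, Complex.normSq_apply] at hh ⊢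
    generalize Complex.exp (Complex.I * θ) = z at hh ⊢
    simp [-Polynomial.eval_mul] at hh ⊢
    linarith
  have hb := (hre S).intervalIntegrable (μ := volume) 0 (2 * Real.pi)
  have hc := ((hn S).const_mul (P.natDegree + lam)).intervalIntegrable
    (μ := volume) 0 (2 * Real.pi)
  refine (intervalIntegral.integral_mono Real.two_pi_pos.le
    (((hre (P * q)).sub (hV.mul (hn (P * q)))).intervalIntegrable _ _) (hb.sub hc) hpt).trans_lt ?_
  rw [intervalIntegral.integral_sub hb hc, intervalIntegral.integral_const_mul]
  have h1 := integral_re_derivative_le S hSd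
  have h2 : 0 < ∫ θ in (0 : ℝ)..(2 * Real.pi), ‖S.eval (Complex.exp (Complex.I * θ))‖ ^ 2 := by
    simp only [hnorm]
    exact integral_norm_sq_eval_pos (mul_ne_zero hP hq)
  push_cast at h1
  nlinarith

theorem exists_polynomial_fourier_span {f : C(AddCircle (2 * Real.pi), ℂ)}
    (hf : f ∈ Submodule.span ℂ (Set.range (@fourier (2 * Real.pi)))) :
    ∃ G K : Polynomial ℂ, ∀ θ : ℝ, f (θ : AddCircle (2 * Real.pi)) =
      G.eval (Complex.exp (Complex.I * θ)) +
        (starRingEnd ℂ) (K.eval (Complex.exp (Complex.I * θ))) := by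
  induction hf using Submodule.span_induction with
  | mem f hf =>
    obtain ⟨n, rfl⟩ := hf
    have key : ∀ θ : ℝ, fourier n (θ : AddCircle (2 * Real.pi)) =
        Complex.exp (n * (Complex.I * θ)) := by
      intro θ
      rw [fourier_coe_apply]
      congr 1
      have : (Real.pi : ℂ) ≠ 0 := by exact_mod_cast Real.pi_ne_zero
      push_cast
      field_simp
    obtain ⟨m, rfl | rfl⟩ := n.eq_nat_or_neg
    · refine ⟨Polynomial.X ^ m, 0, fun θ => ?_⟩
      rw [key]
      simp [← Complex.exp_nat_mul]
    · refine ⟨0, Polynomial.X ^ m, fun θ => ?_⟩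
      rw [key]
      simp [← Complex.exp_nat_mul, ← Complex.exp_conj]
  | zero => exact ⟨0, 0, fun θ => by simp⟩
  | add f₁ f₂ _ _ h₁ h₂ =>
    obtain ⟨G₁, K₁, h₁⟩ := h₁
    obtain ⟨G₂, K₂, h₂⟩ := h₂
    refine ⟨G₁ + G₂, K₁ + K₂, fun θ => ?_⟩
    simp only [ContinuousMap.add_apply, h₁, h₂, Polynomial.eval_add, map_add]
    ring
  | smul c f _ h =>
    obtain ⟨G, K, h⟩ := h
    refine ⟨Polynomial.C c * G, Polynomial.C ((starRingEnd ℂ) c) * K, fun θ => ?_⟩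
    simp [h, mul_add]

/-- Real trigonometric polynomials are uniformly dense in the continuous periodic functions. -/
theorem exists_polynomial_re_approx {V : ℝ → ℝ} (hV : Continuous V)
    (hper : Function.Periodic V (2 * Real.pi)) {ε : ℝ} (hε : 0 < ε) :
    ∃ G : Polynomial ℂ, ∀ θ : ℝ, |V θ - (G.eval (Complex.exp (Complex.I * θ))).re| ≤ ε := by
  have : Fact (0 < 2 * Real.pi) := ⟨Real.two_pi_pos⟩
  let F : C(AddCircle (2 * Real.pi), ℂ) :=
    ⟨fun x => (hper.lift x : ℂ), Complex.continuous_ofReal.comp (continuous_coinduced_dom.2 hV)⟩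
  have hF : F ∈ (Submodule.span ℂ (Set.range (@fourier (2 * Real.pi)))).topologicalClosure := by
    rw [span_fourier_closure_eq_top]
    trivial
  obtain ⟨f, hf, hfF⟩ := Metric.mem_closure_iff.1 hF ε hε
  obtain ⟨G, K, h⟩ := exists_polynomial_fourier_span hf
  refine ⟨G + K, fun θ => ?_⟩
  have h1 := (ContinuousMap.dist_apply_le_dist (f := F) (g := f)
    (θ : AddCircle (2 * Real.pi))).trans hfF.le
  have h2 : F (θ : AddCircle (2 * Real.pi)) = V θ := rfl
  rw [h, h2, Complex.dist_eq] at h1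
  refine (le_of_eq ?_).trans ((Complex.abs_re_le_norm _).trans h1)
  simp

theorem exists_derivative_eq (H : Polynomial ℂ) : ∃ F : Polynomial ℂ, F.derivative = H := by
  induction H using Polynomial.induction_on' with
  | add p q hp hq =>
    obtain ⟨F, rfl⟩ := hp
    obtain ⟨G, rfl⟩ := hq
    exact ⟨F + G, Polynomial.derivative_add⟩
  | monomial n a =>
    refine ⟨Polynomial.monomial (n + 1) (a / (n + 1)), ?_⟩
    have : (n : ℂ) + 1 ≠ 0 := by exact_mod_cast n.succ_ne_zero
    rw [Polynomial.derivative_monomial]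
    congr 1
    push_cast
    field_simp

theorem exists_norm_eval_le (F : Polynomial ℂ) :
    ∃ C : ℝ, ∀ θ : ℝ, ‖F.eval (Complex.exp (Complex.I * θ))‖ ≤ C := by
  obtain ⟨C, hC⟩ := (isCompact_sphere (0 : ℂ) 1).exists_bound_of_continuousOn
    F.continuous.continuousOn
  exact ⟨C, fun θ => hC _ (by
    rw [mem_sphere_zero_iff_norm, mul_comm, Complex.norm_exp_ofReal_mul_I])⟩

theorem re_mul_conj_le {a t : ℂ} {τ : ℝ} (ht : ‖t‖ ≤ τ) (hτ : τ ≤ 1 / 2) :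
    (a * (starRingEnd ℂ) (1 + t)).re ≤ (a.re + 2 * ‖a‖ * τ) * ‖1 + t‖ ^ 2 := by
  have h1 : 1 / 2 ≤ ‖1 + t‖ := by
    have := norm_sub_le (1 + t) t
    simp only [add_sub_cancel_right, norm_one] at this
    linarith
  have h2 : (a * (starRingEnd ℂ) (1 + t)).re - a.re * ‖1 + t‖ ^ 2 =
      (-(a * (starRingEnd ℂ) (1 + t) * t)).re := by
    rw [← Complex.normSq_eq_norm_sq]
    simp [Complex.normSq_apply]
    ring
  have h3 : (-(a * (starRingEnd ℂ) (1 + t) * t)).re ≤ ‖a‖ * ‖1 + t‖ * ‖t‖ := by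
    refine (Complex.re_le_norm _).trans (le_of_eq ?_)
    simp only [norm_neg, norm_mul, Complex.norm_conj]
  have h4 : ‖a‖ * ‖1 + t‖ * ‖t‖ ≤ ‖a‖ * ‖1 + t‖ * τ := by gcongr
  have h5 : 0 ≤ ‖a‖ * τ * ‖1 + t‖ * (2 * ‖1 + t‖ - 1) := by
    have : 0 ≤ τ := (norm_nonneg t).trans ht
    have : 0 ≤ 2 * ‖1 + t‖ - 1 := by linarith
    positivity
  nlinarith

/-- A continuous periodic function dominates, up to a constant close to its mean, the logarithmic
derivative `2 Re (z P' / P)` of a polynomial. -/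
theorem exists_polynomial_log_derivative_le {V : ℝ → ℝ} (hV : Continuous V)
    (hper : Function.Periodic V (2 * Real.pi)) {lam : ℝ}
    (hlam : 2 * Real.pi * lam < ∫ θ in (0 : ℝ)..(2 * Real.pi), V θ) :
    ∃ P : Polynomial ℂ, P ≠ 0 ∧
      ∀ θ : ℝ, lam * ‖P.eval (Complex.exp (Complex.I * θ))‖ ^ 2 +
      2 * (Complex.exp (Complex.I * θ) * P.derivative.eval (Complex.exp (Complex.I * θ)) *
        (starRingEnd ℂ) (P.eval (Complex.exp (Complex.I * θ)))).re ≤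
      V θ * ‖P.eval (Complex.exp (Complex.I * θ))‖ ^ 2 := by
  have hpi := Real.two_pi_pos
  obtain ⟨m, hm⟩ : ∃ m, ∫ θ in (0 : ℝ)..(2 * Real.pi), V θ = 2 * Real.pi * m :=
    ⟨(∫ θ in (0 : ℝ)..(2 * Real.pi), V θ) / (2 * Real.pi), by field_simp⟩
  rw [hm] at hlam
  have hlm : lam < m := lt_of_mul_lt_mul_left hlam hpi.le
  set ε := (m - lam) / 3 with hεdef
  have hε : 0 < ε := by rw [hεdef]; linarith
  obtain ⟨G, hG⟩ := exists_polynomial_re_approx hV hper hε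
  have hG0 : m - ε ≤ (G.coeff 0).re := by
    have hGre : Continuous fun θ : ℝ => (G.eval (Complex.exp (Complex.I * θ))).re :=
      Complex.continuous_re.comp (G.continuous.comp (by fun_prop))
    have h1 : ∫ θ in (0 : ℝ)..(2 * Real.pi), (V θ - ε) ≤
        ∫ θ in (0 : ℝ)..(2 * Real.pi), (G.eval (Complex.exp (Complex.I * θ))).re :=
      intervalIntegral.integral_mono hpi.le ((hV.sub continuous_const).intervalIntegrable _ _)
        (hGre.intervalIntegrable _ _) fun θ => by
          have := (abs_le.1 (hG θ)).2
          simp only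
          linarith
    rw [integral_re_eval, intervalIntegral.integral_sub (hV.intervalIntegrable _ _)
      (continuous_const.intervalIntegrable _ _), hm, intervalIntegral.integral_const] at h1
    simp only [sub_zero, smul_eq_mul] at h1
    rw [← mul_sub] at h1
    exact le_of_mul_le_mul_left h1 hpi
  obtain ⟨F, hF⟩ := exists_derivative_eq (Polynomial.C (1 / 2) * G.divX)
  obtain ⟨C₁, hC₁⟩ := exists_norm_eval_le F
  obtain ⟨C₂, hC₂⟩ := exists_norm_eval_le (Polynomial.X * F.derivative)
  have hC₁0 : 0 ≤ C₁ := (norm_nonneg _).trans (hC₁ 0)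
  have hC₂0 : 0 ≤ C₂ := (norm_nonneg _).trans (hC₂ 0)
  obtain ⟨n, hn⟩ := exists_nat_gt (2 * C₁ + 4 * C₁ * C₂ / ε)
  have hdiv : 0 ≤ 4 * C₁ * C₂ / ε := by positivity
  have hn0 : (0 : ℝ) < n := by linarith
  set τ := C₁ / n with hτdef
  have hτ : τ ≤ 1 / 2 := by
    rw [hτdef, div_le_iff₀ hn0]; linarith
  have hτε : 4 * C₂ * τ ≤ ε := by
    have : 4 * C₁ * C₂ / ε ≤ n := by linarith
    rw [div_le_iff₀ hε] at this
    rw [hτdef, ← mul_div_assoc, div_le_iff₀ hn0]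
    linarith
  obtain ⟨k, rfl⟩ : ∃ k, n = k + 1 :=
    Nat.exists_eq_succ_of_ne_zero (by rintro rfl; simp at hn0)
  set N : ℂ := ((k + 1 : ℕ) : ℂ) with hN
  have hN0 : N ≠ 0 := by rw [hN]; exact_mod_cast k.succ_ne_zero
  set T : Polynomial ℂ := 1 + Polynomial.C (1 / N) * F with hT
  have ht : ∀ θ : ℝ, ‖1 / N * F.eval (Complex.exp (Complex.I * θ))‖ ≤ τ := by
    intro θ
    rw [norm_mul, norm_div, norm_one, hN, Complex.norm_natCast, one_div_mul_eq_div, hτdef]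
    gcongr
    exact hC₁ θ
  have hTe : ∀ z, T.eval z = 1 + 1 / N * F.eval z := fun z => by simp [hT]
  have hT0 : T ≠ 0 := by
    intro h0
    have h1 := hTe (Complex.exp (Complex.I * (0 : ℝ)))
    rw [h0, Polynomial.eval_zero] at h1
    have h2 := ht 0
    rw [← neg_eq_of_add_eq_zero_right h1.symm, norm_neg, norm_one] at h2
    linarith
  refine ⟨T ^ (k + 1), pow_ne_zero _ hT0, fun θ => ?_⟩
  have hV' := (abs_le.1 (hG θ)).1
  have ht' := ht θ
  have ha' := hC₂ θ
  rw [Polynomial.eval_mul, Polynomial.eval_X] at ha'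
  generalize Complex.exp (Complex.I * θ) = z at *
  have hGz : (G.eval z).re = (G.coeff 0).re + 2 * (z * F.derivative.eval z).re := by
    conv_lhs => rw [← G.divX_mul_X_add]
    have : G.divX.eval z * z = 2 * (z * F.derivative.eval z) := by
      rw [hF]
      simp
      ring
    rw [Polynomial.eval_add, Polynomial.eval_C, Polynomial.eval_mul, Polynomial.eval_X, this]
    simp
    ring
  have hmain := re_mul_conj_le (a := z * F.derivative.eval z) ht' hτ
  rw [← hTe] at hmain
  have hP : z * (T ^ (k + 1)).derivative.eval z * (starRingEnd ℂ) ((T ^ (k + 1)).eval z) =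
      ((‖T.eval z‖ ^ 2) ^ k : ℝ) * (z * F.derivative.eval z * (starRingEnd ℂ) (T.eval z)) := by
    have hTd : T.derivative.eval z = 1 / N * F.derivative.eval z := by simp [hT]
    rw [← Complex.normSq_eq_norm_sq, Complex.ofReal_pow, ← Complex.mul_conj,
      Polynomial.derivative_pow_succ, Polynomial.eval_mul, hTd]
    simp only [Polynomial.eval_mul, Polynomial.eval_pow, Polynomial.eval_C, map_pow]
    have : ((k : ℂ) + 1) * (1 / N) = 1 := by
      rw [hN]; push_cast; rw [hN] at hN0; push_cast at hN0; field_simp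
    rw [mul_pow, pow_succ]
    linear_combination z * T.eval z ^ k * Polynomial.eval z F.derivative *
      ((starRingEnd ℂ) (T.eval z) ^ k * (starRingEnd ℂ) (T.eval z)) * this
  rw [hP, Complex.re_ofReal_mul, Polynomial.eval_pow, norm_pow, ← pow_mul, mul_comm (k + 1) 2,
    pow_mul, pow_succ]
  have hpk : 0 ≤ (‖T.eval z‖ ^ 2) ^ k := by positivity
  have hT2 : 0 ≤ ‖T.eval z‖ ^ 2 := by positivity
  have hτ0 : 0 ≤ τ := (norm_nonneg _).trans ht'
  have h1 : 4 * ‖z * F.derivative.eval z‖ * τ ≤ ε := by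
    refine le_trans ?_ hτε
    gcongr
  have h2 : lam * ‖T.eval z‖ ^ 2 +
      2 * (z * F.derivative.eval z * (starRingEnd ℂ) (T.eval z)).re ≤ V θ * ‖T.eval z‖ ^ 2 := by
    have h3 : lam + 2 * ((z * F.derivative.eval z).re + 2 * ‖z * F.derivative.eval z‖ * τ) ≤
        V θ := by
      rw [hGz] at hV'
      linarith
    have := mul_le_mul_of_nonneg_right h3 hT2
    linarith
  have := mul_le_mul_of_nonneg_left h2 hpk
  linarith

/-- Glazman-type lower bound on the unit disc: if `Φ - Φ_g > 0`, there are
`⌈Φ - Φ_g⌉` linearly independent polynomials such that the Robin quadratic form is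
negative on `e^{-φ} p` for every nonzero `p` in their span. -/
theorem stmt_18 (φ : ℂ → ℝ) (U : Set ℂ) (hU : IsOpen U)
    (hDU : Metric.closedBall (0:ℂ) 1 ⊆ U) (hφ : ContDiffOn ℝ (⊤ : ℕ∞) φ U)
    (hφ0 : ∀ z : ℂ, ‖z‖ = 1 → φ z = 0)
    (g : ℝ → ℝ) (hg : Continuous g) (hgper : ∀ θ, g (θ + 2 * Real.pi) = g θ)
    (hflux : (1 / (2 * Real.pi)) * (∫ z in Metric.ball (0:ℂ) 1, Bf φ z)
      - (1 / (2 * Real.pi)) * (∫ θ in (0:ℝ)..(2 * Real.pi), g θ) > 0) :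
    ∃ p : Fin ⌈(1 / (2 * Real.pi)) * (∫ z in Metric.ball (0:ℂ) 1, Bf φ z)
        - (1 / (2 * Real.pi)) * (∫ θ in (0:ℝ)..(2 * Real.pi), g θ)⌉₊ → Polynomial ℂ,
      LinearIndependent ℂ p ∧
      ∀ q ∈ Submodule.span ℂ (Set.range p), q ≠ 0 →
        qform φ g (fun z => Complex.exp (-(φ z : ℂ)) * Polynomial.eval z q) < 0 := by
  set δ := (1 / (2 * Real.pi)) * (∫ z in Metric.ball (0:ℂ) 1, Bf φ z)
      - (1 / (2 * Real.pi)) * (∫ θ in (0:ℝ)..(2 * Real.pi), g θ) with hδ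
  have hpi := Real.two_pi_pos
  have hh := continuous_normalDeriv hU hDU hφ
  have hVc : Continuous fun θ => normalDeriv φ θ - g θ := hh.sub hg
  have hVp : Function.Periodic (fun θ => normalDeriv φ θ - g θ) (2 * Real.pi) :=
    (normalDeriv_periodic φ).sub hgper
  have hmean : ∫ θ in (0 : ℝ)..(2 * Real.pi), (normalDeriv φ θ - g θ) = 2 * Real.pi * δ := by
    rw [intervalIntegral.integral_sub (hh.intervalIntegrable _ _) (hg.intervalIntegrable _ _),
      ← integral_Bf hU hDU hφ, hδ]
    field_simp
  have hceil : 0 < ⌈δ⌉₊ := Nat.ceil_pos.2 hflux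
  have hd : ((⌈δ⌉₊ - 1 : ℕ) : ℝ) < δ := Nat.lt_ceil.1 (Nat.sub_lt hceil one_pos)
  obtain ⟨lam, hlam, hlamδ⟩ := exists_between hd
  obtain ⟨P, hP, hPle⟩ := exists_polynomial_log_derivative_le hVc hVp (lam := lam) (by
    rw [hmean]
    exact mul_lt_mul_of_pos_left hlamδ hpi)
  refine ⟨fun k => P * Polynomial.X ^ (k : ℕ), ?_, fun q hq hq0 => ?_⟩
  · have h1 : LinearIndependent ℂ fun k : Fin ⌈δ⌉₊ => (Polynomial.X : Polynomial ℂ) ^ (k : ℕ) := by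
      have := (Polynomial.basisMonomials ℂ).linearIndependent.comp
        (fun k : Fin ⌈δ⌉₊ => (k : ℕ)) Fin.val_injective
      simpa [Function.comp_def, Polynomial.monomial_one_right_eq_X_pow] using this
    exact h1.map' (LinearMap.mulLeft ℂ P)
      (LinearMap.ker_eq_bot.2 (mul_right_injective₀ hP))
  · obtain ⟨r, rfl, hr⟩ : ∃ r : Polynomial ℂ, P * r = q ∧ r.natDegree ≤ ⌈δ⌉₊ - 1 := by
      clear hq0
      induction hq using Submodule.span_induction with
      | mem x hx =>
        obtain ⟨k, rfl⟩ := hx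
        exact ⟨_, rfl, by
          have := k.2
          simp only [Polynomial.natDegree_X_pow]
          omega⟩
      | zero => exact ⟨0, by simp, by simp⟩
      | add x y _ _ hx hy =>
        obtain ⟨r, rfl, hr⟩ := hx
        obtain ⟨s, rfl, hs⟩ := hy
        exact ⟨r + s, mul_add _ _ _, Polynomial.natDegree_add_le_of_degree_le hr hs⟩
      | smul c x _ hx =>
        obtain ⟨r, rfl, hr⟩ := hx
        exact ⟨c • r, mul_smul_comm _ _ _, (Polynomial.natDegree_smul_le _ _).trans hr⟩
    rw [qform_exp_mul_eval hU hDU hφ hφ0 hg]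
    exact integral_form_neg hVc hP (right_ne_zero_of_mul hq0) hr hlam hPle
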